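/- Suppose every hint is α-good, i.e. ⟨h_t, c_t⟩ ≥ α‖c_t‖² for all t. Then the hint-querying algorithm satisfies: (a) its expected regret, namely sup over ‖u‖ ≤ 1 of Σ_{t=1}^T [ p_t·⟨c_t, −h_t⟩ + (1−p_t)·⟨c_t, x_t⟩ − ⟨c_t, u⟩ ], is at most (78 + 38·log(1 + σ_{1:T}))/α; and (b) its expected query cost Σ_{t=1}^T p_t·α‖c_t‖² is at most 20·√(σ_{1:T}). -/

import Mathlib

open RealInnerProductSpace

/-- Vectors in `ℝ^d` with the Euclidean structure. -/
abbrev Vec (d : ℕ) := EuclideanSpace ℝ (Fin d)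

section Telescoping

lemma sum_Icc_one_eq_sum_range {M : Type*} [AddCommMonoid M] (f : ℕ → M) (n : ℕ) :
    ∑ t ∈ Finset.Icc 1 n, f t = ∑ t ∈ Finset.range n, f (t + 1) := by
  induction n with
  | zero => simp
  | succ k ih => rw [Finset.sum_Icc_succ_top (by omega), Finset.sum_range_succ, ih]

lemma sum_Ico_le_sub {f G : ℕ → ℝ} {m n : ℕ} (hmn : m ≤ n)
    (h : ∀ t, m ≤ t → t < n → f t ≤ G (t + 1) - G t) :
    ∑ t ∈ Finset.Ico m n, f t ≤ G n - G m := by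
  induction n, hmn using Nat.le_induction with
  | base => simp
  | succ k hk ih =>
    rw [Finset.sum_Ico_succ_top hk]
    have h1 := ih fun t h1 h2 => h t h1 (by omega)
    have h2 := h k hk (by omega)
    linarith

lemma div_add_le_log_sub_log {a s : ℝ} (ha : 0 < a) (hs : 0 ≤ s) :
    s / (a + s) ≤ Real.log (a + s) - Real.log a := by
  have hb : 0 < a + s := by linarith
  have h := Real.log_le_sub_one_of_pos (div_pos ha hb)
  rw [Real.log_div ha.ne' hb.ne'] at h
  have : s / (a + s) = 1 - a / (a + s) := by field_simp; ring
  linarith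

lemma div_sqrt_add_le {a s : ℝ} (ha : 0 ≤ a) (hs : 0 ≤ s) :
    s / √(a + s) ≤ 2 * (√(a + s) - √a) := by
  rcases (add_nonneg ha hs).eq_or_lt with h | h
  · rw [← h, Real.sqrt_zero, div_zero, Real.sqrt_eq_zero'.2 (by linarith)]
    simp
  · have hb : 0 < √(a + s) := Real.sqrt_pos.2 h
    rw [div_le_iff₀ hb]
    have h1 := Real.mul_self_sqrt h.le
    have h2 := Real.mul_self_sqrt ha
    nlinarith [sq_nonneg (√(a + s) - √a)]

end Telescoping

section BallClip

variable {E : Type*} [NormedAddCommGroup E] [InnerProductSpace ℝ E]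

/-- The minimizer of `⟪C, ·⟫ + r / 2 * ‖·‖ ^ 2` over the unit ball. -/
noncomputable def ballClip (C : E) (r : ℝ) : E := -((max ‖C‖ r)⁻¹ • C)

lemma norm_ballClip (C : E) {r : ℝ} (hr : 0 < r) : ‖ballClip C r‖ = ‖C‖ / max ‖C‖ r := by
  have hN : 0 < max ‖C‖ r := lt_max_of_lt_right hr
  rw [ballClip, norm_neg, norm_smul, Real.norm_of_nonneg (inv_nonneg.2 hN.le)]
  field_simp

lemma norm_ballClip_le (C : E) {r : ℝ} (hr : 0 < r) : ‖ballClip C r‖ ≤ 1 := by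
  rw [norm_ballClip C hr]
  exact div_le_one_of_le₀ (le_max_left _ _) (le_max_of_le_right hr.le)

lemma norm_ballClip_eq_one {C : E} {r : ℝ} (hr : 0 < r) (h : r ≤ ‖C‖) : ‖ballClip C r‖ = 1 := by
  rw [norm_ballClip C hr, max_eq_left h, div_self (by linarith)]

lemma inner_add_norm_sq_ballClip_le (C : E) {r : ℝ} (hr : 0 < r) {x : E} (hx : ‖x‖ ≤ 1) :
    ⟪C, ballClip C r⟫ + r / 2 * ‖ballClip C r‖ ^ 2 + r / 2 * ‖x - ballClip C r‖ ^ 2 ≤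
      ⟪C, x⟫ + r / 2 * ‖x‖ ^ 2 := by
  have hN : 0 < max ‖C‖ r := lt_max_of_lt_right hr
  set y := ballClip C r with hy
  have hC : C = -(max ‖C‖ r • y) := by
    rw [hy, ballClip, smul_neg, neg_neg, smul_smul, mul_inv_cancel₀ hN.ne', one_smul]
  have h1 : ‖x - y‖ ^ 2 = ‖x‖ ^ 2 - 2 * ⟪y, x⟫ + ‖y‖ ^ 2 := by
    rw [norm_sub_sq_real, real_inner_comm]
  have h2 (w : E) : ⟪C, w⟫ = -(max ‖C‖ r * ⟪y, w⟫) := by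
    conv_lhs => rw [hC]
    rw [inner_neg_left, real_inner_smul_left]
  rw [h1, h2 x, h2 y, real_inner_self_eq_norm_sq]
  have key : 0 ≤ (max ‖C‖ r - r) * (‖y‖ ^ 2 - ⟪y, x⟫) := by
    rcases le_total ‖C‖ r with h | h
    · simp [max_eq_right h]
    · have hy1 : ‖y‖ = 1 := norm_ballClip_eq_one hr h
      have h3 := real_inner_le_norm y x
      rw [hy1] at h3 ⊢
      exact mul_nonneg (by simp) (by linarith)
  linarith

lemma eq_ballClip {C : E} {r : ℝ} (hr : 0 < r) {x : E} (hx : ‖x‖ ≤ 1)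
    (hmin : ∀ y : E, ‖y‖ ≤ 1 → ⟪C, x⟫ + r / 2 * ‖x‖ ^ 2 ≤ ⟪C, y⟫ + r / 2 * ‖y‖ ^ 2) :
    x = ballClip C r := by
  have h1 := inner_add_norm_sq_ballClip_le C hr hx
  have h2 := hmin _ (norm_ballClip_le C hr)
  have h3 : ‖x - ballClip C r‖ ^ 2 ≤ 0 := by
    by_contra! h
    have := mul_pos hr h
    linarith
  rw [← sub_eq_zero, ← norm_eq_zero]
  exact pow_eq_zero_iff two_ne_zero |>.1 (le_antisymm h3 (sq_nonneg _))

lemma norm_ballClip_sub_ballClip_le (C b : E) {r r' : ℝ} (hr : 0 < r) (hr' : r ≤ r')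
    (hb : r' - r ≤ ‖b‖) :
    ‖ballClip C r - ballClip (C + b) r'‖ ≤ 2 * ‖b‖ / max ‖C + b‖ r' := by
  have hM : 0 < max ‖C‖ r := lt_max_of_lt_right hr
  have hN : 0 < max ‖C + b‖ r' := lt_max_of_lt_right (by linarith)
  have hMN : |max ‖C + b‖ r' - max ‖C‖ r| ≤ ‖b‖ := by
    refine (abs_max_sub_max_le_max _ _ _ _).trans (max_le ?_ ?_)
    · simpa using abs_norm_sub_norm_le (C + b) C
    · rwa [abs_of_nonneg (by linarith)]
  have hC := norm_ballClip_le C hr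
  have hid : max ‖C + b‖ r' • (ballClip C r - ballClip (C + b) r') =
      b + (max ‖C + b‖ r' - max ‖C‖ r) • ballClip C r := by
    have h1 : max ‖C + b‖ r' • ballClip (C + b) r' = -(C + b) := by
      rw [ballClip, smul_neg, smul_smul, mul_inv_cancel₀ hN.ne', one_smul]
    have h2 : max ‖C‖ r • ballClip C r = -C := by
      rw [ballClip, smul_neg, smul_smul, mul_inv_cancel₀ hM.ne', one_smul]
    rw [smul_sub, sub_smul, h1, h2]
    abel
  rw [le_div_iff₀ hN]
  calc ‖ballClip C r - ballClip (C + b) r'‖ * max ‖C + b‖ r'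
      = ‖b + (max ‖C + b‖ r' - max ‖C‖ r) • ballClip C r‖ := by
        rw [← hid, norm_smul, Real.norm_of_nonneg hN.le, mul_comm]
    _ ≤ ‖b‖ + |max ‖C + b‖ r' - max ‖C‖ r| * ‖ballClip C r‖ := by
        refine (norm_add_le _ _).trans ?_
        rw [norm_smul, Real.norm_eq_abs]
    _ ≤ ‖b‖ + ‖b‖ * 1 := by gcongr
    _ = 2 * ‖b‖ := by ring

end BallClip

section CumulativeCost

variable {E : Type*} [NormedAddCommGroup E]

/-- The accumulated squared norm of the first `t` costs, shifted by one. -/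
noncomputable def onePlusSq (b : ℕ → E) (t : ℕ) : ℝ := 1 + ∑ s ∈ Finset.range t, ‖b s‖ ^ 2

/-- The accumulated cost after `t` rounds. -/
def cumCost (b : ℕ → E) (t : ℕ) : E := ∑ s ∈ Finset.range t, b s

lemma onePlusSq_zero (b : ℕ → E) : onePlusSq b 0 = 1 := by simp [onePlusSq]

lemma onePlusSq_succ (b : ℕ → E) (t : ℕ) : onePlusSq b (t + 1) = onePlusSq b t + ‖b t‖ ^ 2 := by
  rw [onePlusSq, onePlusSq, Finset.sum_range_succ, add_assoc]

lemma cumCost_succ (b : ℕ → E) (t : ℕ) : cumCost b (t + 1) = cumCost b t + b t :=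
  Finset.sum_range_succ _ _

lemma monotone_onePlusSq (b : ℕ → E) : Monotone (onePlusSq b) :=
  monotone_nat_of_le_succ fun t => by rw [onePlusSq_succ]; linarith [sq_nonneg ‖b t‖]

lemma one_le_onePlusSq (b : ℕ → E) (t : ℕ) : 1 ≤ onePlusSq b t := by
  simpa [onePlusSq_zero] using monotone_onePlusSq b (Nat.zero_le t)

lemma one_le_sqrt_onePlusSq (b : ℕ → E) (t : ℕ) : 1 ≤ √(onePlusSq b t) :=
  Real.one_le_sqrt.2 (one_le_onePlusSq b t)

lemma sqrt_onePlusSq_pos (b : ℕ → E) (t : ℕ) : 0 < √(onePlusSq b t) :=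
  zero_lt_one.trans_le (one_le_sqrt_onePlusSq b t)

lemma sqrt_onePlusSq_mono (b : ℕ → E) {m n : ℕ} (h : m ≤ n) :
    √(onePlusSq b m) ≤ √(onePlusSq b n) :=
  Real.sqrt_le_sqrt (monotone_onePlusSq b h)

lemma sqrt_onePlusSq_succ_sub_le {b : ℕ → E} (hb : ∀ t, ‖b t‖ ≤ 1) (t : ℕ) :
    √(onePlusSq b (t + 1)) - √(onePlusSq b t) ≤ ‖b t‖ := by
  have h1 := Real.mul_self_sqrt (zero_le_one.trans (one_le_onePlusSq b t))
  have h2 := Real.mul_self_sqrt (zero_le_one.trans (one_le_onePlusSq b (t + 1)))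
  have h7 := onePlusSq_succ b t
  have h3 := one_le_sqrt_onePlusSq b t
  have h4 := one_le_sqrt_onePlusSq b (t + 1)
  have h5 := hb t
  have h6 := norm_nonneg (b t)
  nlinarith

/-- The expected query cost is of order the square root of the accumulated squared norm. -/
lemma sum_mul_norm_sq_le {b : ℕ → E} (hb : ∀ t, ‖b t‖ ≤ 1) {α : ℝ} (hα0 : 0 < α)
    {P : ℕ → ℝ} {T : ℕ} (hPle : ∀ t ≤ T, P t ≤ 10 / α / √(onePlusSq b t)) :
    ∑ t ∈ Finset.range T, P t * (α * ‖b t‖ ^ 2) ≤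
      20 * √(∑ t ∈ Finset.range T, ‖b t‖ ^ 2) := by
  have h := sum_Ico_le_sub (f := fun t => P t * (α * ‖b t‖ ^ 2))
    (G := fun t => 20 * √(∑ s ∈ Finset.range t, ‖b s‖ ^ 2)) (Nat.zero_le T) fun t _ ht => by
      have hV : 0 ≤ ∑ s ∈ Finset.range t, ‖b s‖ ^ 2 := by positivity
      have hs1 : ‖b t‖ ^ 2 ≤ 1 := pow_le_one₀ (norm_nonneg _) (hb t)
      have h1 := div_sqrt_add_le hV (sq_nonneg ‖b t‖)
      rw [Finset.sum_range_succ]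
      have h2 : P t * (α * ‖b t‖ ^ 2) ≤ 10 * (‖b t‖ ^ 2 / √(onePlusSq b t)) := by
        refine (mul_le_mul_of_nonneg_right (hPle t ht.le) (by positivity)).trans_eq ?_
        field_simp
      have h3 : ‖b t‖ ^ 2 / √(onePlusSq b t) ≤
          ‖b t‖ ^ 2 / √(∑ s ∈ Finset.range t, ‖b s‖ ^ 2 + ‖b t‖ ^ 2) := by
        rcases (sq_nonneg ‖b t‖).eq_or_lt with h0 | h0
        · simp [← h0]
        · have : √(∑ s ∈ Finset.range t, ‖b s‖ ^ 2 + ‖b t‖ ^ 2) ≤ √(onePlusSq b t) :=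
            Real.sqrt_le_sqrt (by rw [onePlusSq]; linarith)
          gcongr
      linarith
  simpa using h

end CumulativeCost

section FTRL

variable {E : Type*} [NormedAddCommGroup E] [InnerProductSpace ℝ E]

/-- The FTRL iterate after `t` rounds. -/
noncomputable def ftrl (b : ℕ → E) (t : ℕ) : E := ballClip (cumCost b t) √(onePlusSq b t)

/-- The optimal value of the FTRL objective after `t` rounds. -/
noncomputable def ftrlValue (b : ℕ → E) (t : ℕ) : ℝ :=
  ⟪cumCost b t, ftrl b t⟫ + √(onePlusSq b t) / 2 * ‖ftrl b t‖ ^ 2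

variable {b : ℕ → E}

lemma norm_ftrl_le (b : ℕ → E) (t : ℕ) : ‖ftrl b t‖ ≤ 1 :=
  norm_ballClip_le _ (sqrt_onePlusSq_pos b t)

lemma ftrlValue_le (b : ℕ → E) (t : ℕ) {y : E} (hy : ‖y‖ ≤ 1) :
    ftrlValue b t ≤ ⟪cumCost b t, y⟫ + √(onePlusSq b t) / 2 * ‖y‖ ^ 2 := by
  have h := inner_add_norm_sq_ballClip_le (cumCost b t) (sqrt_onePlusSq_pos b t) hy
  refine le_trans ?_ h
  simp only [ftrlValue, ftrl, le_add_iff_nonneg_right]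
  positivity

lemma ftrlValue_zero (b : ℕ → E) : ftrlValue b 0 = 0 := by
  simp [ftrlValue, ftrl, cumCost, ballClip]

lemma neg_norm_cumCost_sub_le_sum_inner_ftrl (b : ℕ → E) (n : ℕ) :
    -‖cumCost b n‖ - (√(onePlusSq b n) - 1) / 2 ≤ ∑ t ∈ Finset.range n, ⟪b t, ftrl b t⟫ := by
  have h := sum_Ico_le_sub (f := fun t => -⟪b t, ftrl b t⟫)
    (G := fun t => √(onePlusSq b t) / 2 - ftrlValue b t) (Nat.zero_le n) fun t _ _ => by
      have h1 := ftrlValue_le b (t + 1) (norm_ftrl_le b t)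
      rw [cumCost_succ, inner_add_left] at h1
      have h2 : ftrlValue b t =
        ⟪cumCost b t, ftrl b t⟫ + √(onePlusSq b t) / 2 * ‖ftrl b t‖ ^ 2 := rfl
      have h3 : (√(onePlusSq b (t + 1)) - √(onePlusSq b t)) * ‖ftrl b t‖ ^ 2 ≤
          (√(onePlusSq b (t + 1)) - √(onePlusSq b t)) * 1 :=
        mul_le_mul_of_nonneg_left (pow_le_one₀ (norm_nonneg _) (norm_ftrl_le b t))
          (sub_nonneg.2 (sqrt_onePlusSq_mono b t.le_succ))
      linarith
  rw [← Finset.range_eq_Ico, Finset.sum_neg_distrib, ftrlValue_zero, onePlusSq_zero,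
    Real.sqrt_one] at h
  have h1 : -‖cumCost b n‖ ≤ ftrlValue b n := by
    have h2 : |⟪cumCost b n, ftrl b n⟫| ≤ ‖cumCost b n‖ * 1 :=
      (abs_real_inner_le_norm _ _).trans
        (mul_le_mul_of_nonneg_left (norm_ftrl_le b n) (norm_nonneg _))
    have h3 : 0 ≤ √(onePlusSq b n) / 2 * ‖ftrl b n‖ ^ 2 := by positivity
    rw [ftrlValue]
    linarith [neg_abs_le ⟪cumCost b n, ftrl b n⟫]
  linarith

/-- The FTRL regret is controlled by the movement of the iterates and by the growth of the
regularizer at the rounds where the iterate is interior to the ball. -/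
lemma sum_inner_ftrl_sub_le (b : ℕ → E) (T : ℕ) {u : E} (hu : ‖u‖ ≤ 1) :
    ∑ t ∈ Finset.range T, ⟪b t, ftrl b t - u⟫ ≤ 1 / 2 + ∑ t ∈ Finset.range T,
      (‖b t‖ * ‖ftrl b t - ftrl b (t + 1)‖ +
        (√(onePlusSq b (t + 1)) - √(onePlusSq b t)) / 2 * (1 - ‖ftrl b (t + 1)‖ ^ 2)) := by
  have h := sum_Ico_le_sub (f := fun t => ⟪b t, ftrl b t⟫ -
      (‖b t‖ * ‖ftrl b t - ftrl b (t + 1)‖ +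
        (√(onePlusSq b (t + 1)) - √(onePlusSq b t)) / 2 * (1 - ‖ftrl b (t + 1)‖ ^ 2)))
    (G := fun t => ftrlValue b t - √(onePlusSq b t) / 2) (Nat.zero_le T) fun t _ _ => by
      have h1 := ftrlValue_le b t (norm_ftrl_le b (t + 1))
      have h2 : ftrlValue b (t + 1) = ⟪cumCost b (t + 1), ftrl b (t + 1)⟫ +
        √(onePlusSq b (t + 1)) / 2 * ‖ftrl b (t + 1)‖ ^ 2 := rfl
      rw [cumCost_succ, inner_add_left] at h2
      have h3 := real_inner_le_norm (b t) (ftrl b t - ftrl b (t + 1))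
      rw [inner_sub_right] at h3
      linarith
  rw [← Finset.range_eq_Ico, Finset.sum_sub_distrib, ftrlValue_zero, onePlusSq_zero,
    Real.sqrt_one] at h
  have h1 := ftrlValue_le b T hu
  have h2 : √(onePlusSq b T) / 2 * ‖u‖ ^ 2 ≤ √(onePlusSq b T) / 2 * 1 :=
    mul_le_mul_of_nonneg_left (pow_le_one₀ (norm_nonneg _) hu) (by positivity)
  simp only [inner_sub_right, Finset.sum_sub_distrib]
  rw [← sum_inner]
  change _ - ⟪cumCost b T, u⟫ ≤ _
  linarith

lemma norm_ftrl_sub_ftrl_succ_le (hb : ∀ t, ‖b t‖ ≤ 1) (t : ℕ) :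
    ‖ftrl b t - ftrl b (t + 1)‖ ≤
      2 * ‖b t‖ / max ‖cumCost b (t + 1)‖ √(onePlusSq b (t + 1)) := by
  have h := norm_ballClip_sub_ballClip_le (cumCost b t) (b t) (sqrt_onePlusSq_pos b t)
    (sqrt_onePlusSq_mono b t.le_succ) (sqrt_onePlusSq_succ_sub_le hb t)
  rw [← cumCost_succ] at h
  exact h

/-- FTRL suffers only logarithmic regret after the last time `n` at which the accumulated cost
is small. -/
lemma sum_inner_ftrl_sub_le_of_large (hb : ∀ t, ‖b t‖ ≤ 1) {α : ℝ} (hα : 0 < α) {n T : ℕ}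
    (hnT : n ≤ T)
    (hlarge : ∀ t, n < t → t ≤ T → α / 4 * onePlusSq b t < ‖cumCost b t‖) {u : E}
    (hu : ‖u‖ ≤ 1) :
    ∑ t ∈ Finset.range T, ⟪b t, ftrl b t - u⟫ ≤
      9 / 2 * √(onePlusSq b n) + 2 / α +
        8 / α * (Real.log (onePlusSq b T) - Real.log (onePlusSq b n)) := by
  refine (sum_inner_ftrl_sub_le b T hu).trans ?_
  rw [Finset.range_eq_Ico, ← Finset.sum_Ico_consecutive _ (Nat.zero_le n) hnT]
  have hearly := sum_Ico_le_sub
    (f := fun t => ‖b t‖ * ‖ftrl b t - ftrl b (t + 1)‖ +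
        (√(onePlusSq b (t + 1)) - √(onePlusSq b t)) / 2 * (1 - ‖ftrl b (t + 1)‖ ^ 2))
    (G := fun t => 9 / 2 * √(onePlusSq b t)) (Nat.zero_le n) fun t _ _ => by
      have h1 : ‖ftrl b t - ftrl b (t + 1)‖ ≤ 2 * ‖b t‖ / √(onePlusSq b (t + 1)) :=
        (norm_ftrl_sub_ftrl_succ_le hb t).trans
          (div_le_div_of_nonneg_left (by positivity) (sqrt_onePlusSq_pos b _) (le_max_right _ _))
      have h2 := mul_le_mul_of_nonneg_left h1 (norm_nonneg (b t))
      have h3 := div_sqrt_add_le (zero_le_one.trans (one_le_onePlusSq b t)) (sq_nonneg ‖b t‖)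
      rw [← onePlusSq_succ] at h3
      have h4 : ‖b t‖ * (2 * ‖b t‖ / √(onePlusSq b (t + 1))) =
        2 * (‖b t‖ ^ 2 / √(onePlusSq b (t + 1))) := by ring
      have h5 := mul_nonneg (sub_nonneg.2 (sqrt_onePlusSq_mono b t.le_succ))
        (sq_nonneg ‖ftrl b (t + 1)‖)
      rw [Nat.succ_eq_add_one] at h5
      linarith
  have hlate := sum_Ico_le_sub
    (f := fun t => ‖b t‖ * ‖ftrl b t - ftrl b (t + 1)‖ +
        (√(onePlusSq b (t + 1)) - √(onePlusSq b t)) / 2 * (1 - ‖ftrl b (t + 1)‖ ^ 2))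
    (G := fun t => 8 / α * Real.log (onePlusSq b t) + min √(onePlusSq b t) (4 / α) / 2)
    hnT fun t hn hT => by
      have hS : 0 < onePlusSq b (t + 1) := zero_lt_one.trans_le (one_le_onePlusSq b _)
      have hl := hlarge (t + 1) (by omega) (by omega)
      have h1 : ‖ftrl b t - ftrl b (t + 1)‖ ≤ 2 * ‖b t‖ / (α / 4 * onePlusSq b (t + 1)) :=
        (norm_ftrl_sub_ftrl_succ_le hb t).trans
          (div_le_div_of_nonneg_left (by positivity) (by positivity)
            (hl.le.trans (le_max_left _ _)))
      have h2 := mul_le_mul_of_nonneg_left h1 (norm_nonneg (b t))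
      have h3 := div_add_le_log_sub_log (zero_lt_one.trans_le (one_le_onePlusSq b t))
        (sq_nonneg ‖b t‖)
      rw [← onePlusSq_succ] at h3
      have h4 : ‖b t‖ * (2 * ‖b t‖ / (α / 4 * onePlusSq b (t + 1))) =
          8 / α * (‖b t‖ ^ 2 / onePlusSq b (t + 1)) := by field_simp; ring
      have h5 := mul_le_mul_of_nonneg_left h3 (show 0 ≤ 8 / α by positivity)
      have hmono := sqrt_onePlusSq_mono b t.le_succ
      rw [Nat.succ_eq_add_one] at hmono
      have h6 : (√(onePlusSq b (t + 1)) - √(onePlusSq b t)) / 2 * (1 - ‖ftrl b (t + 1)‖ ^ 2) ≤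
          min √(onePlusSq b (t + 1)) (4 / α) / 2 - min √(onePlusSq b t) (4 / α) / 2 := by
        rcases le_total √(onePlusSq b (t + 1)) (4 / α) with hr | hr
        · rw [min_eq_left hr, min_eq_left (hmono.trans hr)]
          have := mul_nonneg (sub_nonneg.2 hmono) (sq_nonneg ‖ftrl b (t + 1)‖)
          linarith
        · have hle : √(onePlusSq b (t + 1)) ≤ ‖cumCost b (t + 1)‖ := by
            refine le_trans ?_ hl.le
            rw [div_le_iff₀ hα] at hr
            have := mul_le_mul_of_nonneg_left hr (Real.sqrt_nonneg (onePlusSq b (t + 1)))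
            have := Real.mul_self_sqrt hS.le
            nlinarith
          rw [show ‖ftrl b (t + 1)‖ = 1 from
            norm_ballClip_eq_one (sqrt_onePlusSq_pos b _) hle]
          have := min_le_min_right (4 / α) hmono
          linarith
      linarith
  have h1 : min √(onePlusSq b T) (4 / α) ≤ 4 / α := min_le_right _ _
  have h2 : 0 ≤ min √(onePlusSq b n) (4 / α) := by positivity
  have h3 : 4 / α / 2 = 2 / α := by ring
  simp only [onePlusSq_zero, Real.sqrt_one] at hearly
  linarith

end FTRL

section OGD

/-- One step of projected gradient descent on an interval. -/
lemma sq_clamp_sub_le {B w q : ℝ} (h0 : 0 ≤ q) (hB : q ≤ B) :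
    (max 0 (min B w) - q) ^ 2 ≤ (w - q) ^ 2 := by
  rw [sq_le_sq]
  rcases le_total B w with h | h
  · rw [min_eq_left h, max_eq_right (h0.trans hB), abs_of_nonneg (by linarith),
      abs_of_nonneg (by linarith)]
    linarith
  · rw [min_eq_right h]
    rcases le_total 0 w with h' | h'
    · rw [max_eq_right h']
    · rw [max_eq_left h', abs_of_nonpos (by linarith), abs_of_nonpos (by linarith)]
      linarith

/-- Regret of the querying probabilities on a block of rounds against a fixed comparator that is
feasible throughout the block. -/
lemma sum_mul_sub_le_of_ogd {S s z P : ℕ → ℝ} {l q : ℝ} {m n : ℕ} (hmn : m ≤ n) (hl : 0 < l)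
    (hS1 : ∀ t, 1 ≤ S t) (hS : ∀ t, S (t + 1) = S t + s t) (hs0 : ∀ t, 0 ≤ s t)
    (hs1 : ∀ t, s t ≤ 1) (hz : ∀ t, z t ^ 2 ≤ 4 * s t) (hP0 : ∀ t ≤ n, 0 ≤ P t)
    (hPle : ∀ t ≤ n, P t ≤ l / √(S t))
    (hP : ∀ t < n, P (t + 1) =
      max 0 (min (min 1 (l / √(S (t + 1)))) (P t - l / S (t + 1) * z t)))
    (hq0 : 0 ≤ q) (hq1 : q ≤ 1) (hq : q ≤ l / √(S n)) :
    ∑ t ∈ Finset.Ico m n, z t * (P t - q) ≤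
      l / 2 + 3 * l * (Real.log (S n) - Real.log (S m)) := by
  have hmono : Monotone S := monotone_nat_of_le_succ fun t => by rw [hS]; linarith [hs0 t]
  have hpos (t : ℕ) : 0 < S t := zero_lt_one.trans_le (hS1 t)
  have hqt (t : ℕ) (ht : t ≤ n) : q ≤ l / √(S t) :=
    hq.trans (div_le_div_of_nonneg_left hl.le (Real.sqrt_pos.2 (hpos t))
      (Real.sqrt_le_sqrt (hmono ht)))
  have hdist (t : ℕ) (ht : t ≤ n) : S t * (P t - q) ^ 2 ≤ l ^ 2 := by
    have h1 : |P t - q| ≤ l / √(S t) := abs_sub_le_iff.2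
      ⟨by linarith [hPle t ht], by linarith [hqt t ht, hP0 t ht]⟩
    have h2 := pow_le_pow_left₀ (abs_nonneg _) h1 2
    rw [sq_abs, div_pow, Real.sq_sqrt (hpos t).le, le_div_iff₀ (hpos t)] at h2
    linarith
  have h := sum_Ico_le_sub (f := fun t => z t * (P t - q))
    (G := fun t => 3 * l * Real.log (S t) - S t / (2 * l) * (P t - q) ^ 2) hmn fun t _ ht => by
      have hstep : (P (t + 1) - q) ^ 2 ≤ (P t - l / S (t + 1) * z t - q) ^ 2 := by
        rw [hP t ht]
        exact sq_clamp_sub_le hq0 (le_min hq1 (hqt (t + 1) ht))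
      have hlog := div_add_le_log_sub_log (hpos t) (hs0 t)
      rw [← hS] at hlog
      have hS' := hpos (t + 1)
      have h1 : z t * (P t - q) = S (t + 1) / (2 * l) * (P t - q) ^ 2 -
          S (t + 1) / (2 * l) * (P t - l / S (t + 1) * z t - q) ^ 2 +
            l / 2 * (z t ^ 2 / S (t + 1)) := by
        field_simp
        ring
      have h2 := mul_le_mul_of_nonneg_left hstep
        (show 0 ≤ S (t + 1) / (2 * l) by positivity)
      have h3 : l / 2 * (z t ^ 2 / S (t + 1)) ≤ 2 * l * (s t / S (t + 1)) := by
        have : z t ^ 2 / S (t + 1) ≤ 4 * s t / S (t + 1) := by gcongr; exact hz t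
        have := mul_le_mul_of_nonneg_left this (show 0 ≤ l / 2 by positivity)
        linarith [show l / 2 * (4 * s t / S (t + 1)) = 2 * l * (s t / S (t + 1)) by ring]
      have h4 : s t / (2 * l) * (P t - q) ^ 2 ≤ l * (s t / S (t + 1)) := by
        have hd : S (t + 1) * (P t - q) ^ 2 ≤ 2 * l ^ 2 := by
          have : S (t + 1) ≤ 2 * S t := by rw [hS]; linarith [hs1 t, hS1 t]
          nlinarith [hdist t ht.le, mul_le_mul_of_nonneg_right this (sq_nonneg (P t - q))]
        have := mul_le_mul_of_nonneg_left hd (hs0 t)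
        rw [mul_div_assoc', le_div_iff₀ hS', div_mul_eq_mul_div, div_mul_eq_mul_div,
          div_le_iff₀ (by positivity)]
        linarith
      have h5 : S (t + 1) / (2 * l) * (P t - q) ^ 2 = S t / (2 * l) * (P t - q) ^ 2 +
          s t / (2 * l) * (P t - q) ^ 2 := by rw [hS]; ring
      have h6 := mul_le_mul_of_nonneg_left hlog (show 0 ≤ 3 * l by positivity)
      linarith
  have h1 : S m / (2 * l) * (P m - q) ^ 2 ≤ l / 2 := by
    rw [div_mul_eq_mul_div, div_le_iff₀ (by positivity)]
    linarith [hdist m hmn]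
  have h2 : 0 ≤ S n / (2 * l) * (P n - q) ^ 2 := by have := hpos n; positivity
  linarith

end OGD

section HintQuerying

variable {E : Type*} [NormedAddCommGroup E] [InnerProductSpace ℝ E]

/-- The cost `-α ‖b t‖ ^ 2 - ⟪b t, x⟫` of querying a hint at round `t`, where `x` is the FTRL
iterate. -/
noncomputable def queryCost (α : ℝ) (b : ℕ → E) (t : ℕ) : ℝ :=
  -(α * ‖b t‖ ^ 2) - ⟪b t, ftrl b t⟫

lemma queryCost_sq_le {b : ℕ → E} (hb : ∀ t, ‖b t‖ ≤ 1) {α : ℝ} (hα0 : 0 < α) (hα1 : α ≤ 1)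
    (t : ℕ) : queryCost α b t ^ 2 ≤ 4 * ‖b t‖ ^ 2 := by
  have h0 := norm_nonneg (b t)
  have h1 : |⟪b t, ftrl b t⟫| ≤ ‖b t‖ * 1 := (abs_real_inner_le_norm _ _).trans
    (mul_le_mul_of_nonneg_left (norm_ftrl_le b t) h0)
  have h2 : α * ‖b t‖ ^ 2 ≤ 1 * ‖b t‖ :=
    mul_le_mul hα1 (pow_le_of_le_one h0 (hb t) two_ne_zero) (by positivity) zero_le_one
  have h3 : |queryCost α b t| ≤ 2 * ‖b t‖ := by
    rw [queryCost, abs_le]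
    constructor <;> linarith [abs_le.1 h1, show 0 ≤ α * ‖b t‖ ^ 2 by positivity]
  have h4 := pow_le_pow_left₀ (abs_nonneg _) h3 2
  rw [sq_abs] at h4
  linarith

lemma sum_queryCost_le (α : ℝ) (b : ℕ → E) (n : ℕ) :
    ∑ t ∈ Finset.range n, queryCost α b t ≤
      -(α * (onePlusSq b n - 1)) + ‖cumCost b n‖ + (√(onePlusSq b n) - 1) / 2 := by
  have h1 : α * (onePlusSq b n - 1) = ∑ t ∈ Finset.range n, α * ‖b t‖ ^ 2 := by
    rw [onePlusSq, ← Finset.mul_sum]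
    ring
  have h2 := neg_norm_cumCost_sub_le_sum_inner_ftrl b n
  simp only [queryCost, Finset.sum_sub_distrib, Finset.sum_neg_distrib]
  linarith

/-- Some feasible comparator for the querying probabilities cancels the `√(onePlusSq b n)` regret
of FTRL when the accumulated cost is small. -/
lemma exists_comparator {b : ℕ → E} {α : ℝ} (hα0 : 0 < α) (hα1 : α ≤ 1) {n : ℕ}
    (hn : ‖cumCost b n‖ ≤ α / 4 * onePlusSq b n) :
    ∃ q, 0 ≤ q ∧ q ≤ 1 ∧ q ≤ 10 / α / √(onePlusSq b n) ∧
      9 / 2 * √(onePlusSq b n) + q * ∑ t ∈ Finset.range n, queryCost α b t ≤ 45 / α := by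
  have hr1 := one_le_sqrt_onePlusSq b n
  have hsq := Real.mul_self_sqrt (zero_le_one.trans (one_le_onePlusSq b n))
  have hsum := sum_queryCost_le α b n
  set r := √(onePlusSq b n)
  have hr0 : 0 < r := by linarith
  rcases le_total r (10 / α) with h | h
  · refine ⟨0, le_rfl, zero_le_one, by positivity, ?_⟩
    rw [zero_mul, add_zero, show 45 / α = 9 / 2 * (10 / α) by ring]
    linarith
  · refine ⟨10 / α / r, by positivity, div_le_one_of_le₀ h hr0.le, le_rfl, ?_⟩
    have h1 : ∑ t ∈ Finset.range n, queryCost α b t ≤ -(3 / 4 * α * (r * r)) + 3 / 2 * r := by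
      rw [hsq]
      nlinarith
    have h2 := mul_le_mul_of_nonneg_left h1 (show 0 ≤ 10 / α / r by positivity)
    have h3 : 10 / α / r * (-(3 / 4 * α * (r * r)) + 3 / 2 * r) = -(15 / 2 * r) + 15 / α := by
      field_simp
      ring
    have h4 : 15 / α ≤ 45 / α := by gcongr; norm_num
    linarith

lemma sum_inner_ftrl_sub_add_mul_queryCost_le {b : ℕ → E} (hb : ∀ t, ‖b t‖ ≤ 1) {α : ℝ}
    (hα0 : 0 < α) (hα1 : α ≤ 1) {P : ℕ → ℝ} {T : ℕ} (hP0 : ∀ t ≤ T, 0 ≤ P t)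
    (hPle : ∀ t ≤ T, P t ≤ 10 / α / √(onePlusSq b t))
    (hP : ∀ t < T, P (t + 1) = max 0 (min (min 1 (10 / α / √(onePlusSq b (t + 1))))
      (P t - 10 / α / onePlusSq b (t + 1) * queryCost α b t)))
    {u : E} (hu : ‖u‖ ≤ 1) :
    ∑ t ∈ Finset.range T, (⟪b t, ftrl b t - u⟫ + P t * queryCost α b t) ≤
      (78 + 38 * Real.log (onePlusSq b T)) / α := by
  classical
  set n := Nat.findGreatest (fun t => ‖cumCost b t‖ ≤ α / 4 * onePlusSq b t) T
  have hnT : n ≤ T := Nat.findGreatest_le T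
  have hsmall : ‖cumCost b n‖ ≤ α / 4 * onePlusSq b n :=
    Nat.findGreatest_spec (P := fun t => ‖cumCost b t‖ ≤ α / 4 * onePlusSq b t)
      (Nat.zero_le T) (by
        simp only [cumCost, onePlusSq_zero, Finset.range_zero, Finset.sum_empty, norm_zero]
        positivity)
  have hlarge : ∀ t, n < t → t ≤ T → α / 4 * onePlusSq b t < ‖cumCost b t‖ :=
    fun t h1 h2 => not_le.1 (Nat.findGreatest_is_greatest h1 h2)
  obtain ⟨q, hq0, hq1, hq, hcancel⟩ := exists_comparator hα0 hα1 hsmall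
  have hl : 0 < 10 / α := by positivity
  have hs1 (t : ℕ) : ‖b t‖ ^ 2 ≤ 1 := pow_le_one₀ (norm_nonneg _) (hb t)
  have hftrl := sum_inner_ftrl_sub_le_of_large hb hα0 hnT hlarge hu
  have hearly := sum_mul_sub_le_of_ogd (Nat.zero_le n) hl (one_le_onePlusSq b)
    (onePlusSq_succ b) (fun t => sq_nonneg _) hs1 (queryCost_sq_le hb hα0 hα1)
    (fun t ht => hP0 t (ht.trans hnT)) (fun t ht => hPle t (ht.trans hnT))
    (fun t ht => hP t (ht.trans_le hnT)) hq0 hq1 hq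
  have hlate := sum_mul_sub_le_of_ogd hnT hl (one_le_onePlusSq b)
    (onePlusSq_succ b) (fun t => sq_nonneg _) hs1 (queryCost_sq_le hb hα0 hα1)
    hP0 hPle hP le_rfl zero_le_one (by positivity)
  have hsplit : ∑ t ∈ Finset.range T, P t * queryCost α b t =
      ∑ t ∈ Finset.Ico 0 n, queryCost α b t * (P t - q) +
        q * ∑ t ∈ Finset.range n, queryCost α b t +
          ∑ t ∈ Finset.Ico n T, queryCost α b t * (P t - 0) := by
    rw [Finset.range_eq_Ico, ← Finset.sum_Ico_consecutive _ (Nat.zero_le n) hnT,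
      ← Finset.range_eq_Ico, Finset.mul_sum, ← Finset.sum_add_distrib]
    congr 1 <;> exact Finset.sum_congr rfl fun t _ => by ring
  rw [onePlusSq_zero, Real.log_one] at hearly
  have hlog : 0 ≤ 8 / α * Real.log (onePlusSq b n) :=
    mul_nonneg (by positivity) (Real.log_nonneg (one_le_onePlusSq b n))
  rw [Finset.sum_add_distrib, hsplit]
  have hfin : (78 + 38 * Real.log (onePlusSq b T)) / α =
      21 / α + 45 / α + 2 / α + 10 / α + 8 / α * Real.log (onePlusSq b T) +
        3 * (10 / α) * Real.log (onePlusSq b T) := by ring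
  have h21 : 0 ≤ 21 / α := by positivity
  rw [hfin]
  have h10 : 10 / α / 2 + 10 / α / 2 = 10 / α := by ring
  linarith

end HintQuerying

/-- Theorem 3.3: when every hint is `α`-good, the hint-querying algorithm
(FTRL iterates `x_t`, OGD querying probabilities `p_t` with `λ = 10/α` and costs
`z_t = −α‖c_t‖² − ⟨c_t, x_t⟩`) has expected regret at most `(78 + 38 log(1+σ_{1:T}))/α`
and expected query cost at most `20·√(σ_{1:T})`. -/
theorem stmt4 {d T : ℕ} (α : ℝ) (hα0 : 0 < α) (hα1 : α ≤ 1)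
    (c h x : ℕ → Vec d)
    (hc : ∀ t ∈ Finset.Icc 1 T, ‖c t‖ ≤ 1)
    (hh : ∀ t ∈ Finset.Icc 1 T, ‖h t‖ ≤ 1)
    (hgood : ∀ t ∈ Finset.Icc 1 T, α * ‖c t‖ ^ 2 ≤ ⟪h t, c t⟫)
    (hx1 : x 1 = 0)
    (hxball : ∀ t ∈ Finset.Icc 1 T, ‖x (t + 1)‖ ≤ 1)
    (hxmin : ∀ t ∈ Finset.Icc 1 T, ∀ y : Vec d, ‖y‖ ≤ 1 →
      ⟪(∑ s ∈ Finset.Icc 1 t, c s), x (t + 1)⟫ +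
          Real.sqrt (1 + ∑ s ∈ Finset.Icc 1 t, ‖c s‖ ^ 2) / 2 * ‖x (t + 1)‖ ^ 2 ≤
        ⟪(∑ s ∈ Finset.Icc 1 t, c s), y⟫ +
          Real.sqrt (1 + ∑ s ∈ Finset.Icc 1 t, ‖c s‖ ^ 2) / 2 * ‖y‖ ^ 2)
    (z : ℕ → ℝ)
    (hz : ∀ t, z t = -(α * ‖c t‖ ^ 2) - ⟪c t, x t⟫)
    (p : ℕ → ℝ) (hp1 : p 1 = 0)
    (hp : ∀ t ∈ Finset.Icc 1 T,
      p (t + 1) =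
        max 0 (min (min 1 ((10 / α) / Real.sqrt (1 + ∑ s ∈ Finset.Icc 1 t, ‖c s‖ ^ 2)))
          (p t - (10 / α) / (1 + ∑ s ∈ Finset.Icc 1 t, ‖c s‖ ^ 2) * z t))) :
    (∀ u : Vec d, ‖u‖ ≤ 1 →
        ∑ t ∈ Finset.Icc 1 T,
            (p t * ⟪c t, -h t⟫ + (1 - p t) * ⟪c t, x t⟫ - ⟪c t, u⟫) ≤
          (78 + 38 * Real.log (1 + ∑ s ∈ Finset.Icc 1 T, ‖c s‖ ^ 2)) / α) ∧
      ∑ t ∈ Finset.Icc 1 T, p t * (α * ‖c t‖ ^ 2) ≤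
        20 * Real.sqrt (∑ s ∈ Finset.Icc 1 T, ‖c s‖ ^ 2) := by
  set b : ℕ → Vec d := fun t => if t < T then c (t + 1) else 0 with hbdef
  have hbc (t : ℕ) (ht : t < T) : b t = c (t + 1) := if_pos ht
  have hb (t : ℕ) : ‖b t‖ ≤ 1 := by
    by_cases ht : t < T
    · rw [hbc t ht]
      exact hc _ (Finset.mem_Icc.2 ⟨by omega, by omega⟩)
    · simp [hbdef, ht]
  have hsq (t : ℕ) (ht : t ≤ T) :
      ∑ s ∈ Finset.Icc 1 t, ‖c s‖ ^ 2 = ∑ s ∈ Finset.range t, ‖b s‖ ^ 2 := by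
    rw [sum_Icc_one_eq_sum_range]
    exact Finset.sum_congr rfl fun s hs => by
      rw [hbc s ((Finset.mem_range.1 hs).trans_le ht)]
  have hS (t : ℕ) (ht : t ≤ T) : 1 + ∑ s ∈ Finset.Icc 1 t, ‖c s‖ ^ 2 = onePlusSq b t := by
    rw [hsq t ht, onePlusSq]
  have hC (t : ℕ) (ht : t ≤ T) : ∑ s ∈ Finset.Icc 1 t, c s = cumCost b t := by
    rw [sum_Icc_one_eq_sum_range]
    exact Finset.sum_congr rfl fun s hs => by
      rw [hbc s ((Finset.mem_range.1 hs).trans_le ht)]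
  have hx (t : ℕ) (ht : t ≤ T) : x (t + 1) = ftrl b t := by
    rcases t.eq_zero_or_pos with rfl | h0
    · simp [hx1, ftrl, cumCost, ballClip]
    · have hmem : t ∈ Finset.Icc 1 T := Finset.mem_Icc.2 ⟨h0, ht⟩
      refine eq_ballClip (sqrt_onePlusSq_pos b t) (hxball t hmem) ?_
      simpa only [hS t ht, hC t ht] using hxmin t hmem
  have hP (t : ℕ) (ht : t < T) : p (t + 1 + 1) =
      max 0 (min (min 1 (10 / α / √(onePlusSq b (t + 1))))
        (p (t + 1) - 10 / α / onePlusSq b (t + 1) * queryCost α b t)) := by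
    rw [hp (t + 1) (Finset.mem_Icc.2 ⟨by omega, ht⟩), hS (t + 1) ht, hz, hx t ht.le,
      ← hbc t ht, queryCost]
  have hP0 (t : ℕ) (ht : t ≤ T) : 0 ≤ p (t + 1) := by
    cases t with
    | zero => simp [hp1]
    | succ k => rw [hP k ht]; exact le_max_left _ _
  have hPle (t : ℕ) (ht : t ≤ T) : p (t + 1) ≤ 10 / α / √(onePlusSq b t) := by
    cases t with
    | zero => rw [zero_add, hp1]; positivity
    | succ k =>
      rw [hP k ht]
      exact max_le (by positivity) ((min_le_left _ _).trans (min_le_right _ _))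
  rw [hS T le_rfl, hsq T le_rfl]
  refine ⟨fun u hu => ?_, ?_⟩
  · refine le_trans ?_ (sum_inner_ftrl_sub_add_mul_queryCost_le hb hα0 hα1
      (P := fun t => p (t + 1)) hP0 hPle hP hu)
    rw [sum_Icc_one_eq_sum_range]
    refine Finset.sum_le_sum fun t ht => ?_
    have ht' := Finset.mem_range.1 ht
    have hg := hgood (t + 1) (Finset.mem_Icc.2 ⟨by omega, ht'⟩)
    rw [hx t ht'.le, queryCost, hbc t ht', inner_sub_right, inner_neg_right,
      real_inner_comm (h (t + 1))]
    have := mul_le_mul_of_nonneg_left hg (hP0 t ht'.le)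
    linarith
  · refine le_trans (le_of_eq ?_) (sum_mul_norm_sq_le hb hα0 (P := fun t => p (t + 1)) hPle)
    rw [sum_Icc_one_eq_sum_range]
    exact Finset.sum_congr rfl fun t ht => by rw [hbc t (Finset.mem_range.1 ht)]
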